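/- arXiv:1909.03347 — 2 statements merged into one kernel-verified Lean document; each statement's English description precedes it below -/
import Mathlib

section
/- Let K : ℝ^d × ℝ^d → ℝ be an L-Lipschitz kernel and fix any matrix A ∈ ℝ^{n×n}. Then the map X ↦ ‖K(X) − A‖_op from ℝ^{d×n} to ℝ is (2√n L)-Lipschitz with respect to the Frobenius norm on ℝ^{d×n}; that is, | ‖K(X) − A‖_op − ‖K(X') − A‖_op | ≤ 2√n L ‖X − X'‖_F for all X, X' ∈ ℝ^{d×n}. -/
open Matrix

/-- The ℓ2 operator norm of a real matrix. -/
noncomputable def l2opNorm {m n : ℕ} (A : Matrix (Fin m) (Fin n) ℝ) : ℝ :=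
  ‖LinearMap.toContinuousLinearMap (Matrix.toEuclideanLin A)‖

/-- The Frobenius norm of a real matrix. -/
noncomputable def frobNorm {m n : ℕ} (A : Matrix (Fin m) (Fin n) ℝ) : ℝ :=
  Real.sqrt (∑ i, ∑ j, (A i j) ^ 2)

/-- `K` is an `L`-Lipschitz kernel on `ℝ^d`. -/
def IsLipKernel {d : ℕ} (L : ℝ)
    (K : EuclideanSpace ℝ (Fin d) → EuclideanSpace ℝ (Fin d) → ℝ) : Prop :=
  ∀ x₁ x₂ y₁ y₂, |K x₁ x₂ - K y₁ y₂| ≤ L * (‖x₁ - y₁‖ + ‖x₂ - y₂‖)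

/-- The `i`-th column of a `d × n` matrix, as a vector of `ℝ^d`. -/
noncomputable def col' {d n : ℕ} (X : Matrix (Fin d) (Fin n) ℝ) (i : Fin n) :
    EuclideanSpace ℝ (Fin d) :=
  (WithLp.equiv 2 (Fin d → ℝ)).symm fun k => X k i

lemma l2opNorm_le_frobNorm {m n : ℕ} (A : Matrix (Fin m) (Fin n) ℝ) :
    l2opNorm A ≤ frobNorm A := by
  refine ContinuousLinearMap.opNorm_le_bound _ (Real.sqrt_nonneg _) fun x => ?_
  have h : ‖LinearMap.toContinuousLinearMap (Matrix.toEuclideanLin A) x‖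
      = Real.sqrt (∑ i, (∑ j, A i j * x j) ^ 2) := by
    rw [EuclideanSpace.norm_eq]
    simp [Matrix.toLpLin_apply, Matrix.mulVec, dotProduct]
  rw [h, EuclideanSpace.norm_eq, frobNorm, ← Real.sqrt_mul (by positivity)]
  apply Real.sqrt_le_sqrt
  rw [Finset.sum_mul]
  refine Finset.sum_le_sum fun i _ => ?_
  simpa using Finset.sum_mul_sq_le_sq_mul_sq Finset.univ (fun j => A i j) (fun j => x j)

lemma abs_l2opNorm_sub_le {m n : ℕ} (A B : Matrix (Fin m) (Fin n) ℝ) :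
    |l2opNorm A - l2opNorm B| ≤ l2opNorm (A - B) := by
  unfold l2opNorm
  rw [map_sub, map_sub]
  exact abs_norm_sub_norm_le _ _

lemma frobNorm_eq_col {d n : ℕ} (X X' : Matrix (Fin d) (Fin n) ℝ) :
    frobNorm (X - X') = Real.sqrt (∑ i, ‖col' X i - col' X' i‖ ^ 2) := by
  unfold frobNorm
  rw [Finset.sum_comm]
  congr 1
  refine Finset.sum_congr rfl fun i _ => ?_
  rw [EuclideanSpace.norm_sq_eq]
  simp [col']

/-- For an `L`-Lipschitz kernel `K` and a fixed matrix `A ∈ ℝ^{n×n}`, the map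
`X ↦ ‖K(X) − A‖_op` is `(2√n L)`-Lipschitz w.r.t. the Frobenius norm on `ℝ^{d×n}`. -/
theorem opNorm_kerMatrix_sub_lipschitz {d n : ℕ} (L : ℝ)
    (K : EuclideanSpace ℝ (Fin d) → EuclideanSpace ℝ (Fin d) → ℝ)
    (hK : IsLipKernel L K)
    (A : Matrix (Fin n) (Fin n) ℝ)
    (X X' : Matrix (Fin d) (Fin n) ℝ) :
    |l2opNorm ((Matrix.of fun i j => K (col' X i) (col' X j)) - A)
        - l2opNorm ((Matrix.of fun i j => K (col' X' i) (col' X' j)) - A)|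
      ≤ 2 * Real.sqrt n * L * frobNorm (X - X') := by
  have hL : |L| * frobNorm (X - X') = L * frobNorm (X - X') := by
    rcases le_or_gt 0 L with h | h
    · rw [abs_of_nonneg h]
    · have h0 : ∀ i, ‖col' X i - col' X' i‖ = 0 := fun i => by
        have h1 := (abs_nonneg _).trans (hK (col' X i) 0 (col' X' i) 0)
        simp only [sub_self, norm_zero, add_zero] at h1
        nlinarith [norm_nonneg (col' X i - col' X' i)]
      have : frobNorm (X - X') = 0 := by
        rw [frobNorm_eq_col]; simp only [h0]; simp
      simp [this]
  refine (abs_l2opNorm_sub_le _ _).trans ((l2opNorm_le_frobNorm _).trans ?_)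
  rw [mul_assoc, ← hL, sub_sub_sub_cancel_right]
  have hF : frobNorm (X - X') ^ 2 = ∑ i, ‖col' X i - col' X' i‖ ^ 2 := by
    rw [frobNorm_eq_col, Real.sq_sqrt (by positivity)]
  have hF0 : 0 ≤ frobNorm (X - X') := Real.sqrt_nonneg _
  rw [frobNorm.eq_def (_ - _ : Matrix (Fin n) (Fin n) ℝ)]
  refine Real.sqrt_le_iff.2 ⟨by positivity, ?_⟩
  rw [mul_pow, mul_pow, mul_pow, hF, Real.sq_sqrt (Nat.cast_nonneg n), sq_abs]
  have hb : ∀ i j : Fin n, (K (col' X i) (col' X j) - K (col' X' i) (col' X' j)) ^ 2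
      ≤ 2 * L ^ 2 * (‖col' X i - col' X' i‖ ^ 2 + ‖col' X j - col' X' j‖ ^ 2) := fun i j => by
    have h1 := hK (col' X i) (col' X j) (col' X' i) (col' X' j)
    have h2 := sq_le_sq' (abs_le.1 h1).1 (abs_le.1 h1).2
    refine h2.trans ?_
    nlinarith [sq_nonneg (L * (‖col' X i - col' X' i‖ - ‖col' X j - col' X' j‖))]
  refine (Finset.sum_le_sum fun i _ => Finset.sum_le_sum fun j _ => hb i j).trans_eq ?_
  simp only [← Finset.mul_sum, Finset.sum_add_distrib, Finset.sum_const, Finset.card_univ,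
    Fintype.card_fin, nsmul_eq_mul]
  ring
end

section
/- Let z_1, z_2 be independent standard Gaussian vectors in ℝ^d (z_i ~ N(0, I_d)), let μ_1, μ_2 ∈ ℝ^d, σ_1, σ_2 ≥ 0 and τ > 0. Set X = μ_1 + σ_1 z_1 and Y = μ_2 + σ_2 z_2. Then for the Gaussian kernel, E[ exp( −‖X − Y‖²/(2τ²) ) ] = s^{−d} exp( −‖μ_1 − μ_2‖² / (2 s² τ²) ), where s² = 1 + (σ_1² + σ_2²)/τ². -/
open MeasureTheory ProbabilityTheory

/-- The standard Gaussian measure `N(0, I_d)` on `ℝ^d`, as the product of `d` standard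
one-dimensional Gaussians. -/
noncomputable def stdGaussianE (d : ℕ) : Measure (EuclideanSpace ℝ (Fin d)) :=
  Measure.map (⇑(WithLp.equiv 2 (Fin d → ℝ)).symm)
    (Measure.pi fun _ : Fin d => gaussianReal 0 1)

theorem aux_one (a σ t : ℝ) (ht : 0 < t) :
    ∫ x, Real.exp (-(a + σ * x) ^ 2 / (2 * t)) ∂(gaussianReal 0 1)
      = Real.sqrt (t / (t + σ ^ 2)) * Real.exp (-a ^ 2 / (2 * (t + σ ^ 2))) := by
  have hp : 0 < t + σ ^ 2 := by positivity
  rw [integral_gaussianReal_eq_integral_smul one_ne_zero]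
  have h1 : ∀ x : ℝ, gaussianPDFReal 0 1 x • Real.exp (-(a + σ * x) ^ 2 / (2 * t))
      = ((Real.sqrt (2 * Real.pi))⁻¹ * Real.exp (-a ^ 2 / (2 * (t + σ ^ 2)))) *
        Real.exp (-((t + σ ^ 2) / (2 * t)) * (x + a * σ / (t + σ ^ 2)) ^ 2) := by
    intro x
    simp only [gaussianPDFReal, smul_eq_mul, NNReal.coe_one, mul_one, sub_zero]
    rw [mul_assoc, mul_assoc, ← Real.exp_add, ← Real.exp_add]
    congr 2
    field_simp
    ring
  simp_rw [h1]
  rw [integral_const_mul,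
    integral_add_right_eq_self (fun x : ℝ => Real.exp (-((t + σ ^ 2) / (2 * t)) * x ^ 2)),
    integral_gaussian]
  have h2 : Real.pi / ((t + σ ^ 2) / (2 * t)) = (2 * Real.pi) * (t / (t + σ ^ 2)) := by
    field_simp
  rw [h2, Real.sqrt_mul (x := 2 * Real.pi) (by positivity) (t / (t + σ ^ 2))]
  have h3 : Real.sqrt (2 * Real.pi) ≠ 0 := by positivity
  field_simp

theorem aux_meas (d : ℕ) : Measurable (⇑(WithLp.equiv 2 (Fin d → ℝ)).symm) :=
  WithLp.measurable_toLp 2 (Fin d → ℝ)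

theorem aux_prob (d : ℕ) : IsProbabilityMeasure (stdGaussianE d) :=
  Measure.isProbabilityMeasure_map (aux_meas d).aemeasurable

theorem aux_d (d : ℕ) (v : EuclideanSpace ℝ (Fin d)) (σ t : ℝ) (ht : 0 < t) :
    ∫ z, Real.exp (-‖v + σ • z‖ ^ 2 / (2 * t)) ∂(stdGaussianE d)
      = Real.sqrt (t / (t + σ ^ 2)) ^ d * Real.exp (-‖v‖ ^ 2 / (2 * (t + σ ^ 2))) := by
  rw [stdGaussianE, integral_map (aux_meas d).aemeasurable
    (Continuous.aestronglyMeasurable (by fun_prop))]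
  have h1 : ∀ x : Fin d → ℝ,
      Real.exp (-‖v + σ • (WithLp.equiv 2 (Fin d → ℝ)).symm x‖ ^ 2 / (2 * t))
      = ∏ i, Real.exp (-(v i + σ * x i) ^ 2 / (2 * t)) := by
    intro x
    rw [← Real.exp_sum, EuclideanSpace.real_norm_sq_eq, ← Finset.sum_div, Finset.sum_neg_distrib]
    rfl
  simp_rw [h1]
  rw [integral_fintype_prod_eq_prod (μ := fun _ : Fin d => gaussianReal 0 1)
    (fun i (y : ℝ) => Real.exp (-(v i + σ * y) ^ 2 / (2 * t)))]
  simp_rw [aux_one _ _ _ ht]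
  rw [Finset.prod_mul_distrib, ← Real.exp_sum, EuclideanSpace.real_norm_sq_eq, ← Finset.sum_div,
    Finset.sum_neg_distrib]
  simp

/-- Mean of the Gaussian kernel under Gaussian perturbations: for independent
`z₁, z₂ ~ N(0, I_d)`, `X = μ₁ + σ₁ z₁`, `Y = μ₂ + σ₂ z₂`, and bandwidth `τ > 0`,
`E[exp(−‖X − Y‖²/(2τ²))] = s^{−d} exp(−‖μ₁ − μ₂‖²/(2 s² τ²))`,
where `s² = 1 + (σ₁² + σ₂²)/τ²`. -/
theorem gaussian_kernel_mean (d : ℕ) (μ₁ μ₂ : EuclideanSpace ℝ (Fin d))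
    (σ₁ σ₂ : ℝ) (hσ₁ : 0 ≤ σ₁) (hσ₂ : 0 ≤ σ₂) (τ : ℝ) (hτ : 0 < τ)
    (s : ℝ) (hs : s = Real.sqrt (1 + (σ₁ ^ 2 + σ₂ ^ 2) / τ ^ 2)) :
    (∫ p : EuclideanSpace ℝ (Fin d) × EuclideanSpace ℝ (Fin d),
        Real.exp (-‖(μ₁ + σ₁ • p.1) - (μ₂ + σ₂ • p.2)‖ ^ 2 / (2 * τ ^ 2))
        ∂((stdGaussianE d).prod (stdGaussianE d)))
      = (1 / s ^ d) * Real.exp (-‖μ₁ - μ₂‖ ^ 2 / (2 * s ^ 2 * τ ^ 2)) := by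
  haveI := aux_prob d
  rw [integral_prod_symm]
  · have e1 : ∀ x y : EuclideanSpace ℝ (Fin d),
        (μ₁ + σ₁ • x) - (μ₂ + σ₂ • y) = (μ₁ - μ₂ - σ₂ • y) + σ₁ • x := fun x y => by abel
    have e2 : ∀ y : EuclideanSpace ℝ (Fin d),
        μ₁ - μ₂ - σ₂ • y = (μ₁ - μ₂) + (-σ₂) • y := fun y => by
      rw [neg_smul, sub_eq_add_neg]
    simp_rw [e1, aux_d d _ σ₁ (τ ^ 2) (by positivity)]
    rw [integral_const_mul]
    simp_rw [e2, aux_d d _ (-σ₂) (τ ^ 2 + σ₁ ^ 2) (by positivity)]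
    have hs2 : s ^ 2 = 1 + (σ₁ ^ 2 + σ₂ ^ 2) / τ ^ 2 := by
      rw [hs, Real.sq_sqrt (by positivity)]
    rw [← mul_assoc, ← mul_pow, ← Real.sqrt_mul (by positivity), hs2]
    congr 1
    · rw [hs, one_div, ← inv_pow, ← Real.sqrt_inv]
      congr 2
      field_simp
      ring
    · congr 2
      field_simp
      ring
  · refine Integrable.of_bound (C := 1) (Continuous.aestronglyMeasurable (by fun_prop)) ?_
    refine Filter.Eventually.of_forall fun p => ?_
    rw [Real.norm_eq_abs, Real.abs_exp, Real.exp_le_one_iff, neg_div]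
    exact neg_nonpos.mpr (by positivity)
end
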